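/- Sears' second ${}_4\phi_3$ transformation: Let $n \ge 0$ be an integer and let $q, a, b, c, d, e, f$ be nonzero complex numbers satisfying $def = abcq^{1-n}$, such that all factors occurring in denominators below are nonzero. Then $\sum_{k=0}^{n} \frac{(q^{-n};q)_k (a;q)_k (b;q)_k (c;q)_k}{(q;q)_k (d;q)_k (e;q)_k (f;q)_k} q^k = \frac{(a;q)_n (ef/(ab);q)_n (ef/(ac);q)_n}{(e;q)_n (f;q)_n (ef/(abc);q)_n} \sum_{k=0}^{n} \frac{(q^{-n};q)_k (e/a;q)_k (f/a;q)_k (ef/(abc);q)_k}{(q;q)_k (ef/(ab);q)_k (ef/(ac);q)_k (q^{1-n}/a;q)_k} q^k$. -/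

import Mathlib

set_option autoImplicit false

/-- The q-shifted factorial `(a;q)_n = ∏_{j=0}^{n-1} (1 - a q^j)`. -/
noncomputable def qPoch (q a : ℂ) (n : ℕ) : ℂ := ∏ j ∈ Finset.range n, (1 - a * q ^ j)

theorem qPoch_zero (q a : ℂ) : qPoch q a 0 = 1 := by simp [qPoch]

theorem qPoch_succ (q a : ℂ) (n : ℕ) : qPoch q a (n + 1) = qPoch q a n * (1 - a * q ^ n) := by
  simp [qPoch, Finset.prod_range_succ]

theorem qPoch_add (q a : ℂ) (m n : ℕ) :
    qPoch q a (m + n) = qPoch q a m * qPoch q (a * q ^ m) n := by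
  simp only [qPoch, Finset.prod_range_add]
  congr 1
  exact Finset.prod_congr rfl fun j _ => by ring

theorem qPoch_succ' (q a : ℂ) (n : ℕ) :
    qPoch q a (n + 1) = (1 - a) * qPoch q (a * q) n := by
  rw [add_comm, qPoch_add]
  simp [qPoch_succ, qPoch_zero]

theorem qPoch_ne_zero_of_le {q a : ℂ} {m n : ℕ} (h : qPoch q a n ≠ 0) (hmn : m ≤ n) :
    qPoch q a m ≠ 0 := by
  obtain ⟨k, rfl⟩ := Nat.exists_eq_add_of_le hmn
  rw [qPoch_add] at h
  exact left_ne_zero_of_mul h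

/-- The factor `(-1)^n q^{-n(n-1)/2}` arising when a q-shifted factorial is reversed. -/
noncomputable def qRevFactor (q : ℂ) (n : ℕ) : ℂ := ∏ i ∈ Finset.range n, (-(q ^ i)⁻¹)

theorem qRevFactor_ne_zero {q : ℂ} (hq : q ≠ 0) (n : ℕ) : qRevFactor q n ≠ 0 :=
  Finset.prod_ne_zero_iff.2 fun i _ => neg_ne_zero.2 (inv_ne_zero (pow_ne_zero i hq))

theorem qRevFactor_sq {q : ℂ} (hq : q ≠ 0) (n : ℕ) :
    qRevFactor q n ^ 2 * q ^ (n * n) = q ^ n := by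
  induction n with
  | zero => simp [qRevFactor]
  | succ n ih =>
    have h : qRevFactor q (n + 1) = qRevFactor q n * (-(q ^ n)⁻¹) := by
      simp [qRevFactor, Finset.prod_range_succ]
    have hn : q ^ n ≠ 0 := pow_ne_zero n hq
    calc qRevFactor q (n + 1) ^ 2 * q ^ ((n + 1) * (n + 1))
        = (qRevFactor q n ^ 2 * q ^ (n * n)) * ((q ^ n)⁻¹ * q ^ n) ^ 2 * q := by rw [h]; ring
      _ = q ^ (n + 1) := by rw [ih, inv_mul_cancel₀ hn]; ring

theorem qPoch_reverse {q x y : ℂ} (hq : q ≠ 0) (hx : x ≠ 0) (n : ℕ) (h : y * q ^ n = x * q) :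
    qPoch q y n = x ^ n * qRevFactor q n * qPoch q x⁻¹ n := by
  unfold qPoch qRevFactor
  rw [← Finset.prod_range_reflect, ← Finset.card_range n, ← Finset.prod_const,
    Finset.card_range, ← Finset.prod_mul_distrib, ← Finset.prod_mul_distrib]
  refine Finset.prod_congr rfl fun i hi => ?_
  have hi' := Finset.mem_range.1 hi
  have hqi : q ^ i ≠ 0 := pow_ne_zero i hq
  have key : y * q ^ (n - 1 - i) * q ^ i = x := by
    apply mul_right_cancel₀ hq
    rw [← h, mul_assoc, mul_assoc, ← pow_succ, ← pow_add]
    congr 2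
    omega
  have key' : y * q ^ (n - 1 - i) = x * (q ^ i)⁻¹ := by
    rw [← key]; field_simp
  rw [key']
  field_simp
  ring

/-- The summand of the q-Pfaff–Saalschütz sum, indexed by pairs `(j, m)` with `j + m` fixed. -/
noncomputable def saalTerm (q A B E : ℂ) (p : ℕ × ℕ) : ℂ :=
  qPoch q A p.1 * qPoch q B p.1 * qPoch q (A * B * E * q ^ p.1) p.2 * qPoch q E p.2 * E ^ p.1 /
    (qPoch q q p.1 * qPoch q q p.2)

/-- The telescoping certificate for `saalTerm`. -/
noncomputable def saalCert (q A B E : ℂ) (p : ℕ × ℕ) : ℂ :=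
  (1 - q ^ p.1) * (1 - q ^ p.2) *
    (qPoch q A p.1 * qPoch q B p.1 * qPoch q (A * B * E * q ^ p.1) (p.2 - 1) * qPoch q E p.2 *
      E ^ p.1 / (qPoch q q p.1 * qPoch q q p.2))

theorem saalTerm_recurrence {q A B E : ℂ} (j m : ℕ) (hj : qPoch q q (j + 1) ≠ 0)
    (hm : qPoch q q (m + 1) ≠ 0) :
    (1 - q ^ (m + 1)) * saalTerm q A B E (j, m + 1) +
        q ^ m * ((1 - q ^ (j + 1)) * saalTerm q A B E (j + 1, m)) =
      (1 - A * E * q ^ (j + m)) * (1 - B * E * q ^ (j + m)) * saalTerm q A B E (j, m) +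
        A * B * E * q ^ (j + m) *
          (saalCert q A B E (j + 1, m) - saalCert q A B E (j, m + 1)) := by
  obtain ⟨v, hv⟩ : ∃ v, v = 1 - q * q ^ j := ⟨_, rfl⟩
  obtain ⟨w, hw⟩ : ∃ w, w = 1 - q * q ^ m := ⟨_, rfl⟩
  have hjs : qPoch q q (j + 1) = qPoch q q j * v := by rw [qPoch_succ, hv]
  have hms : qPoch q q (m + 1) = qPoch q q m * w := by rw [qPoch_succ, hw]
  rw [hjs] at hj
  rw [hms] at hm
  obtain ⟨hj1, hj2⟩ := mul_ne_zero_iff.1 hj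
  obtain ⟨hm1, hm2⟩ := mul_ne_zero_iff.1 hm
  have hP : A * B * E * q ^ (j + 1) = A * B * E * q ^ j * q := by ring
  simp only [saalTerm, saalCert, Nat.add_sub_cancel, hP, hjs, hms, qPoch_succ q A j,
    qPoch_succ q B j, qPoch_succ q E m]
  clear hj hm hjs hms hP
  rcases m with _ | m
  · simp only [qPoch_succ, qPoch_zero, pow_succ, pow_zero, add_zero, zero_add] at *
    generalize q ^ j = x at *
    field_simp
    rw [hv, hw]
    ring
  · rw [qPoch_succ' q (A * B * E * q ^ j) (m + 1), qPoch_succ' q (A * B * E * q ^ j) m,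
      qPoch_succ q (A * B * E * q ^ j * q) m, Nat.add_sub_cancel]
    generalize qPoch q q (m + 1) = Q at *
    generalize qPoch q E (m + 1) = R at *
    generalize qPoch q (A * B * E * q ^ j * q) m = S at *
    simp only [pow_succ, pow_add] at *
    generalize q ^ j = x at *
    generalize q ^ m = y at *
    field_simp
    rw [hv, hw]
    ring

theorem sum_saalTerm {q : ℂ} (A B E : ℂ) (n : ℕ) (h : qPoch q q n ≠ 0) :
    ∑ p ∈ Finset.HasAntidiagonal.antidiagonal n, saalTerm q A B E p =
      qPoch q (A * E) n * qPoch q (B * E) n / qPoch q q n := by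
  induction n with
  | zero => simp [saalTerm, qPoch_zero]
  | succ n ih =>
    have hn : qPoch q q n * (1 - q * q ^ n) ≠ 0 := by rwa [← qPoch_succ]
    obtain ⟨hn1, hn2⟩ := mul_ne_zero_iff.1 hn
    have hcert : ∑ p ∈ Finset.HasAntidiagonal.antidiagonal n, saalCert q A B E (p.1 + 1, p.2) =
        ∑ p ∈ Finset.HasAntidiagonal.antidiagonal n, saalCert q A B E (p.1, p.2 + 1) := by
      have h1 := Finset.Nat.sum_antidiagonal_succ (n := n) (f := saalCert q A B E)
      have h2 := Finset.Nat.sum_antidiagonal_succ' (n := n) (f := saalCert q A B E)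
      have h3 : saalCert q A B E (0, n + 1) = 0 := by simp [saalCert]
      have h4 : saalCert q A B E (n + 1, 0) = 0 := by simp [saalCert]
      rw [h3, zero_add] at h1
      rw [h4] at h2
      rw [← h1, h2]
      ring
    have hsplit : (1 - q * q ^ n) *
          ∑ p ∈ Finset.HasAntidiagonal.antidiagonal (n + 1), saalTerm q A B E p =
        ∑ p ∈ Finset.HasAntidiagonal.antidiagonal n,
          ((1 - q ^ (p.2 + 1)) * saalTerm q A B E (p.1, p.2 + 1) +
          q ^ p.2 * ((1 - q ^ (p.1 + 1)) * saalTerm q A B E (p.1 + 1, p.2))) := by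
      have h1 := Finset.Nat.sum_antidiagonal_succ' (n := n)
        (f := fun p => (1 - q ^ p.2) * saalTerm q A B E p)
      have h2 := Finset.Nat.sum_antidiagonal_succ (n := n)
        (f := fun p => q ^ p.2 * ((1 - q ^ p.1) * saalTerm q A B E p))
      simp only [pow_zero, sub_self, zero_mul, mul_zero, zero_add] at h1 h2
      rw [Finset.sum_add_distrib, ← h1, ← h2, ← Finset.sum_add_distrib, Finset.mul_sum]
      refine Finset.sum_congr rfl fun p hp => ?_
      have hp' := Finset.HasAntidiagonal.mem_antidiagonal.1 hp
      have : q * q ^ n = q ^ p.1 * q ^ p.2 := by rw [← pow_add, hp', pow_succ']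
      rw [this]
      ring
    have hrec : (1 - q * q ^ n) *
          ∑ p ∈ Finset.HasAntidiagonal.antidiagonal (n + 1), saalTerm q A B E p =
        (1 - A * E * q ^ n) * (1 - B * E * q ^ n) *
          ∑ p ∈ Finset.HasAntidiagonal.antidiagonal n, saalTerm q A B E p := by
      rw [hsplit]
      calc _ = ∑ p ∈ Finset.HasAntidiagonal.antidiagonal n,
            ((1 - A * E * q ^ n) * (1 - B * E * q ^ n) * saalTerm q A B E p +
            A * B * E * q ^ n *
              (saalCert q A B E (p.1 + 1, p.2) - saalCert q A B E (p.1, p.2 + 1))) := by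
            refine Finset.sum_congr rfl fun p hp => ?_
            have hp' := Finset.HasAntidiagonal.mem_antidiagonal.1 hp
            rw [← hp']
            exact saalTerm_recurrence p.1 p.2 (qPoch_ne_zero_of_le h (by omega))
              (qPoch_ne_zero_of_le h (by omega))
        _ = _ := by
            rw [Finset.sum_add_distrib, ← Finset.mul_sum, ← Finset.mul_sum,
              Finset.sum_sub_distrib, hcert, sub_self, mul_zero, add_zero]
    rw [ih hn1] at hrec
    apply mul_left_cancel₀ hn2
    rw [hrec, qPoch_succ, qPoch_succ, qPoch_succ]
    generalize 1 - q * q ^ n = w at hn2 ⊢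
    field_simp

/-- For `z = q^{-(j+m)}`, the shifted factorial `(z;q)_j` in terms of `(q;q)_{j+m} / (q;q)_m`. -/
theorem qPoch_neg_pow {q z : ℂ} (hq : q ≠ 0) (j m : ℕ) (hz : z * q ^ (j + m) = 1) :
    qPoch q z j * (q ^ m * q) ^ j * qPoch q q m = qRevFactor q j * qPoch q q (j + m) := by
  have hx : (q ^ m * q)⁻¹ ≠ 0 := inv_ne_zero (mul_ne_zero (pow_ne_zero m hq) hq)
  have hqm : q ^ m ≠ 0 := pow_ne_zero m hq
  rw [qPoch_reverse hq hx j, inv_inv, add_comm j m, qPoch_add, mul_comm (q ^ m) q, inv_pow]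
  · field_simp
  · rw [pow_add] at hz
    field_simp
    linear_combination hz

/-- The q-Pfaff–Saalschütz summation. -/
theorem q_saalschutz {q A B C D z : ℂ} (hq : q ≠ 0) (hA : A ≠ 0) (hB : B ≠ 0) (hC : C ≠ 0)
    (hD : D ≠ 0) (n : ℕ) (hz : z * q ^ n = 1) (hbal : C * D * q ^ n = A * B * q)
    (hqn : qPoch q q n ≠ 0) (hCn : qPoch q C n ≠ 0) (hDn : qPoch q D n ≠ 0) :
    ∑ p ∈ Finset.HasAntidiagonal.antidiagonal n,
      qPoch q z p.1 * qPoch q A p.1 * qPoch q B p.1 * q ^ p.1 /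
        (qPoch q q p.1 * qPoch q C p.1 * qPoch q D p.1) =
      A ^ n * qPoch q (C / A) n * qPoch q (D / A) n / (qPoch q C n * qPoch q D n) := by
  have hsum := sum_saalTerm (q := q) A B (C / (A * B)) n hqn
  have hs := qRevFactor_ne_zero hq
  have hAE : A * (C / (A * B)) = C / B := by field_simp
  have hBE : B * (C / (A * B)) = C / A := by field_simp
  have hABE : A * B * (C / (A * B)) = C := by field_simp
  have hrev : qPoch q (C / B) n = (A / D) ^ n * qRevFactor q n * qPoch q (D / A) n := by
    rw [qPoch_reverse hq (div_ne_zero hA hD) n, inv_div]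
    field_simp
    linear_combination hbal
  have hterm : ∀ p ∈ Finset.HasAntidiagonal.antidiagonal n,
      qPoch q z p.1 * qPoch q A p.1 * qPoch q B p.1 * q ^ p.1 /
        (qPoch q q p.1 * qPoch q C p.1 * qPoch q D p.1) =
      qPoch q q n * D ^ n / (qPoch q C n * qRevFactor q n * qPoch q D n) *
        saalTerm q A B (C / (A * B)) p := by
    rintro ⟨j, m⟩ hp
    obtain rfl : j + m = n := Finset.HasAntidiagonal.mem_antidiagonal.1 hp
    have hqj := qPoch_ne_zero_of_le hqn (Nat.le_add_right j m)
    have hqm := qPoch_ne_zero_of_le hqn (Nat.le_add_left m j)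
    have hDj := qPoch_ne_zero_of_le hDn (Nat.le_add_right j m)
    have hz' := qPoch_neg_pow hq j m hz
    have hE1 : qPoch q (C / (A * B)) (j + m) =
        D⁻¹ ^ (j + m) * qRevFactor q (j + m) * qPoch q D (j + m) := by
      rw [qPoch_reverse hq (inv_ne_zero hD) (j + m), inv_inv]
      field_simp
      linear_combination hbal
    have hE2 : qPoch q (C / (A * B)) (m + j) = qPoch q (C / (A * B)) m *
        (D⁻¹ ^ j * qRevFactor q j * qPoch q D j) := by
      rw [qPoch_add, qPoch_reverse hq (inv_ne_zero hD) j (y := C / (A * B) * q ^ m), inv_inv]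
      rw [pow_add] at hbal
      field_simp
      linear_combination hbal
    have hEm : qPoch q (C / (A * B)) m = D⁻¹ ^ (j + m) * qRevFactor q (j + m) *
        qPoch q D (j + m) / (D⁻¹ ^ j * qRevFactor q j * qPoch q D j) := by
      rw [eq_div_iff (mul_ne_zero (mul_ne_zero (pow_ne_zero _ (inv_ne_zero hD)) (hs j)) hDj),
        ← hE2, ← hE1, add_comm]
    have hEval : C / (A * B) = q / (D * q ^ (j + m)) := by
      rw [div_eq_div_iff (mul_ne_zero hA hB) (mul_ne_zero hD (pow_ne_zero _ hq))]
      linear_combination hbal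
    have hzj : qPoch q z j = qRevFactor q j * qPoch q q (j + m) /
        ((q ^ m * q) ^ j * qPoch q q m) := by
      rw [eq_div_iff (mul_ne_zero (pow_ne_zero _ (mul_ne_zero (pow_ne_zero _ hq) hq)) hqm)]
      linear_combination hz'
    have hsq := qRevFactor_sq hq j
    have hsj := hs j
    have hsjm := hs (j + m)
    rw [qPoch_add q C] at hCn ⊢
    obtain ⟨hC1, hC2⟩ := mul_ne_zero_iff.1 hCn
    simp only [saalTerm, hABE, hEm, hzj]
    rw [hEval]
    have hqp : q ^ j ≠ 0 := pow_ne_zero _ hq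
    have hqp' : q ^ (m * j) ≠ 0 := pow_ne_zero _ hq
    have hqp2 : q ^ (j * j) ≠ 0 := pow_ne_zero _ hq
    have e1 : (q ^ m * q) ^ j = q ^ (m * j) * q ^ j := by ring
    have e2 : (q / (D * q ^ (j + m))) ^ j = q ^ j / (D ^ j * (q ^ (j * j) * q ^ (m * j))) := by
      rw [div_pow]; congr 1; ring
    generalize qPoch q (C * q ^ j) m = G at hC2 ⊢
    rw [e1, e2, inv_pow, inv_pow, ← hsq]
    field_simp
  rw [Finset.sum_congr rfl hterm, ← Finset.mul_sum, hsum, hAE, hBE, hrev, div_pow]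
  have hsn := hs n
  field_simp

/-- Sears' first transformation, with the powers of `a` absorbed into the sum. -/
theorem sears_4phi3_first {q a b c d e f z : ℂ} (hq : q ≠ 0) (ha : a ≠ 0) (hb : b ≠ 0)
    (hc : c ≠ 0) (hd : d ≠ 0) (he : e ≠ 0) (hf : f ≠ 0) (n : ℕ) (hz : z * q ^ n = 1)
    (hbal : d * e * f * q ^ n = a * b * c * q) (hqn : qPoch q q n ≠ 0) (hdn : qPoch q d n ≠ 0)
    (hen : qPoch q e n ≠ 0) (hfn : qPoch q f n ≠ 0) :
    ∑ k ∈ Finset.range (n + 1),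
      qPoch q z k * qPoch q a k * qPoch q b k * qPoch q c k * q ^ k /
        (qPoch q q k * qPoch q d k * qPoch q e k * qPoch q f k) =
      ∑ j ∈ Finset.range (n + 1), qPoch q z j * qPoch q a j * qPoch q (d / b) j *
        qPoch q (d / c) j * (b * c / d) ^ j * q ^ j * (a * q ^ j) ^ (n - j) *
        qPoch q (e / a) (n - j) * qPoch q (f / a) (n - j) /
        (qPoch q q j * qPoch q d j * (qPoch q e n * qPoch q f n)) := by
  set E := b * c / d with hE
  have hE0 : E ≠ 0 := div_ne_zero (mul_ne_zero hb hc) hd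
  have hAE : d / b * E = c := by rw [hE]; field_simp
  have hBE : d / c * E = b := by rw [hE]; field_simp
  have hABE : d / b * (d / c) * E = d := by rw [hE]; field_simp
  have hbalE : e * f * q ^ n = a * E * q := by
    rw [hE]; field_simp; linear_combination hbal
  let F : ℕ → ℕ → ℂ := fun j m =>
    qPoch q z (j + m) * qPoch q a (j + m) * q ^ (j + m) /
      (qPoch q e (j + m) * qPoch q f (j + m)) *
      (qPoch q (d / b) j * qPoch q (d / c) j * E ^ j / (qPoch q q j * qPoch q d j)) *
      (qPoch q E m / qPoch q q m)
  calc _ = ∑ k ∈ Finset.range (n + 1), ∑ i ∈ Finset.range (k + 1), F i (k - i) := by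
        refine Finset.sum_congr rfl fun k hk => ?_
        have hkn : k ≤ n := Nat.lt_succ_iff.1 (Finset.mem_range.1 hk)
        have hqk := qPoch_ne_zero_of_le hqn hkn
        have hdk := qPoch_ne_zero_of_le hdn hkn
        have hsum := sum_saalTerm (d / b) (d / c) E k hqk
        rw [hAE, hBE, eq_div_iff hqk] at hsum
        calc _ = qPoch q z k * qPoch q a k * q ^ k / (qPoch q e k * qPoch q f k * qPoch q d k) *
              ∑ p ∈ Finset.HasAntidiagonal.antidiagonal k, saalTerm q (d / b) (d / c) E p := by
              have hek := qPoch_ne_zero_of_le hen hkn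
              have hfk := qPoch_ne_zero_of_le hfn hkn
              rw [div_mul_eq_mul_div, div_eq_div_iff (by simp [*]) (by simp [*])]
              linear_combination -(qPoch q z k * qPoch q a k * q ^ k * qPoch q d k *
                qPoch q e k * qPoch q f k) * hsum
          _ = _ := by
            rw [← Finset.Nat.sum_antidiagonal_eq_sum_range_succ F, Finset.mul_sum]
            refine Finset.sum_congr rfl ?_
            rintro ⟨j, m⟩ hp
            obtain rfl : j + m = k := Finset.HasAntidiagonal.mem_antidiagonal.1 hp
            rw [qPoch_add q d] at hdk ⊢
            obtain ⟨hd1, hd2⟩ := mul_ne_zero_iff.1 hdk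
            simp only [F, saalTerm, hABE]
            generalize qPoch q (d * q ^ j) m = G at hd2 ⊢
            field_simp
    _ = ∑ j ∈ Finset.range (n + 1), ∑ m ∈ Finset.range (n + 1 - j), F j m :=
        Finset.sum_range_diag_flip _ _
    _ = _ := by
        refine Finset.sum_congr rfl fun j hj => ?_
        obtain ⟨M, rfl⟩ := Nat.exists_eq_add_of_le (Nat.lt_succ_iff.1 (Finset.mem_range.1 hj))
        have hqj : q ^ j ≠ 0 := pow_ne_zero j hq
        have hqM := qPoch_ne_zero_of_le hqn (Nat.le_add_left M j)
        rw [qPoch_add] at hen hfn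
        obtain ⟨he1, he2⟩ := mul_ne_zero_iff.1 hen
        obtain ⟨hf1, hf2⟩ := mul_ne_zero_iff.1 hfn
        have hsaal := q_saalschutz (A := a * q ^ j) (B := E) (C := e * q ^ j) (D := f * q ^ j)
          (z := z * q ^ j) hq (mul_ne_zero ha hqj) hE0 (mul_ne_zero he hqj) (mul_ne_zero hf hqj) M
          (by rw [mul_assoc, ← pow_add, hz])
          (by rw [pow_add] at hbalE; linear_combination q ^ j * hbalE) hqM he2 hf2
        rw [mul_div_mul_right _ _ hqj, mul_div_mul_right _ _ hqj,
          Finset.Nat.sum_antidiagonal_eq_sum_range_succ_mk] at hsaal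
        rw [add_assoc, Nat.add_sub_cancel_left, Nat.add_sub_cancel_left, qPoch_add q e,
          qPoch_add q f]
        calc _ = qPoch q z j * qPoch q a j * qPoch q (d / b) j * qPoch q (d / c) j * E ^ j *
              q ^ j / (qPoch q q j * qPoch q d j * (qPoch q e j * qPoch q f j)) *
              ((a * q ^ j) ^ M * qPoch q (e / a) M * qPoch q (f / a) M /
                (qPoch q (e * q ^ j) M * qPoch q (f * q ^ j) M)) := by
              rw [← hsaal, Finset.mul_sum]
              refine Finset.sum_congr rfl fun m _ => ?_
              simp only [F, qPoch_add, pow_add, div_eq_mul_inv, mul_inv]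
              ring
          _ = _ := by
              simp only [div_eq_mul_inv, mul_inv]
              ring

/-- Sears' second ₄φ₃ transformation. -/
theorem sears_4phi3_second (n : ℕ) (q a b c d e f : ℂ) (hq : q ≠ 0) (ha : a ≠ 0) (hb : b ≠ 0)
    (hc : c ≠ 0) (hd : d ≠ 0) (he : e ≠ 0) (hf : f ≠ 0)
    (hbal : d * e * f = a * b * c * q ^ (1 - (n : ℤ)))
    (hden1 : ∀ k ≤ n, qPoch q q k * qPoch q d k * qPoch q e k * qPoch q f k ≠ 0)
    (hden2 : ∀ k ≤ n,
      qPoch q (e * f / (a * b)) k * qPoch q (e * f / (a * c)) k *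
        qPoch q (q ^ (1 - (n : ℤ)) / a) k ≠ 0)
    (hden3 : qPoch q (e * f / (a * b * c)) n ≠ 0) :
    ∑ k ∈ Finset.range (n + 1),
      qPoch q (q ^ (-(n : ℤ))) k * qPoch q a k * qPoch q b k * qPoch q c k * q ^ k /
        (qPoch q q k * qPoch q d k * qPoch q e k * qPoch q f k)
    = qPoch q a n * qPoch q (e * f / (a * b)) n * qPoch q (e * f / (a * c)) n /
        (qPoch q e n * qPoch q f n * qPoch q (e * f / (a * b * c)) n) *
        ∑ k ∈ Finset.range (n + 1),
          qPoch q (q ^ (-(n : ℤ))) k * qPoch q (e / a) k * qPoch q (f / a) k *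
            qPoch q (e * f / (a * b * c)) k * q ^ k /
          (qPoch q q k * qPoch q (e * f / (a * b)) k * qPoch q (e * f / (a * c)) k *
            qPoch q (q ^ (1 - (n : ℤ)) / a) k) := by
  have hz : q ^ (-(n : ℤ)) * q ^ n = 1 := by
    rw [zpow_neg, zpow_natCast, inv_mul_cancel₀ (pow_ne_zero n hq)]
  have hz1 : q ^ (1 - (n : ℤ)) * q ^ n = q := by
    rw [sub_eq_add_neg, zpow_add₀ hq, mul_assoc, hz, zpow_one, mul_one]
  generalize q ^ (-(n : ℤ)) = z at *
  generalize q ^ (1 - (n : ℤ)) = w at *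
  have hbal' : d * e * f * q ^ n = a * b * c * q := by
    rw [hbal, mul_assoc _ w, hz1]
  have h1 := hden1 n le_rfl
  have h2 := hden2 n le_rfl
  simp only [mul_ne_zero_iff] at h1 h2
  obtain ⟨⟨⟨hqn, hdn⟩, hen⟩, hfn⟩ := h1
  obtain ⟨⟨hgn, hhn⟩, hrn⟩ := h2
  rw [sears_4phi3_first hq ha hb hc hd he hf n hz hbal' hqn hdn hen hfn,
    ← Finset.sum_range_reflect, Finset.mul_sum]
  refine Finset.sum_congr rfl fun k hk => ?_
  obtain ⟨j, rfl⟩ := Nat.exists_eq_add_of_le (Nat.lt_succ_iff.1 (Finset.mem_range.1 hk))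
  have hs := qRevFactor_ne_zero hq
  have hqj : q ^ j ≠ 0 := pow_ne_zero j hq
  have hqk : q ^ k ≠ 0 := pow_ne_zero k hq
  have hqjk : q ^ (j * k) ≠ 0 := pow_ne_zero _ hq
  have hqqj := qPoch_ne_zero_of_le hqn (Nat.le_add_left j k)
  have hqqk := qPoch_ne_zero_of_le hqn (Nat.le_add_right k j)
  have hdj := qPoch_ne_zero_of_le hdn (Nat.le_add_left j k)
  have hpk := qPoch_ne_zero_of_le hden3 (Nat.le_add_right k j)
  have hrk := qPoch_ne_zero_of_le hrn (Nat.le_add_right k j)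
  have hgk := qPoch_ne_zero_of_le hgn (Nat.le_add_right k j)
  have hhk := qPoch_ne_zero_of_le hhn (Nat.le_add_right k j)
  have hidx : k + j + 1 - 1 - k = j := by omega
  have hidx' : k + j - j = k := by omega
  rw [hidx, hidx']
  rw [pow_add] at hbal' hz hz1
  have hg : qPoch q (e * f / (a * b)) (k + j) = qPoch q (e * f / (a * b)) k *
      ((c / d) ^ j * qRevFactor q j * qPoch q (d / c) j) := by
    rw [qPoch_add, qPoch_reverse hq (div_ne_zero hc hd) j (y := _ * q ^ k), inv_div]
    field_simp
    linear_combination hbal'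
  have hh : qPoch q (e * f / (a * c)) (k + j) = qPoch q (e * f / (a * c)) k *
      ((b / d) ^ j * qRevFactor q j * qPoch q (d / b) j) := by
    rw [qPoch_add, qPoch_reverse hq (div_ne_zero hb hd) j (y := _ * q ^ k), inv_div]
    field_simp
    linear_combination hbal'
  have hp : qPoch q (e * f / (a * b * c)) (k + j) = qPoch q (e * f / (a * b * c)) k *
      (d⁻¹ ^ j * qRevFactor q j * qPoch q d j) := by
    rw [qPoch_add, qPoch_reverse hq (inv_ne_zero hd) j (y := _ * q ^ k), inv_inv]
    field_simp
    linear_combination hbal'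
  have hr : qPoch q (w / a) k = (a * q ^ j)⁻¹ ^ k * qRevFactor q k * qPoch q (a * q ^ j) k := by
    rw [qPoch_reverse hq (inv_ne_zero (mul_ne_zero ha hqj)) k, inv_inv]
    field_simp
    linear_combination hz1
  have hak : qPoch q (a * q ^ j) k ≠ 0 := by
    rw [hr] at hrk
    exact right_ne_zero_of_mul hrk
  have hzk := qPoch_neg_pow (z := z) hq k j (by rw [pow_add, hz])
  have hzj := qPoch_neg_pow (z := z) hq j k (by rw [pow_add, mul_comm (q ^ j), hz])
  rw [add_comm j k] at hzj
  rw [← eq_div_iff hqqj, ← eq_div_iff (pow_ne_zero _ (mul_ne_zero hqj hq))] at hzk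
  rw [← eq_div_iff hqqk, ← eq_div_iff (pow_ne_zero _ (mul_ne_zero hqk hq))] at hzj
  have ha' : qPoch q a (k + j) = qPoch q a j * qPoch q (a * q ^ j) k := by
    rw [add_comm, qPoch_add]
  rw [hg, hh, hp, hr, ha', hzk, hzj]
  have e1 : (a * q ^ j)⁻¹ ^ k = (a ^ k * q ^ (j * k))⁻¹ := by rw [inv_pow]; ring
  have e2 : (a * q ^ j) ^ k = a ^ k * q ^ (j * k) := by ring
  have e3 : (q ^ j * q) ^ k = q ^ (j * k) * q ^ k := by ring
  have e4 : (q ^ k * q) ^ j = q ^ (j * k) * q ^ j := by ring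
  rw [e1, e2, e3, e4]
  have hsj := hs j
  have hsk := hs k
  generalize qPoch q (a * q ^ j) k = G1 at hak ⊢
  generalize qPoch q (e * f / (a * b)) k = G2 at hgk ⊢
  generalize qPoch q (e * f / (a * c)) k = G3 at hhk ⊢
  generalize qPoch q (e * f / (a * b * c)) k = G4 at hpk ⊢
  generalize qPoch q (e / a) k = G5
  generalize qPoch q (f / a) k = G6
  generalize qPoch q (d / b) j = G7
  generalize qPoch q (d / c) j = G8
  generalize q ^ (j * k) = G9 at hqjk ⊢
  generalize q ^ j = G10 at hqj ⊢
  generalize q ^ k = G11 at hqk ⊢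
  field_simp
  have hpow : (b * c / d) ^ j * (1 / d) ^ j = (c / d) ^ j * (b / d) ^ j := by
    rw [← mul_pow, ← mul_pow]
    congr 1
    ring
  linear_combination qPoch q a j * G7 * G8 * G5 * G6 * hpow
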